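/- arXiv:1108.5294 — 3 statements merged into one kernel-verified Lean document; each statement's English description precedes it below -/
import Mathlib

section
/- For every ε > 0 there exists a constant C such that for every integer N ≥ 1, the number of tuples (n₁, …, n₅, m₁, …, m₅) of integers in {−N, …, N} satisfying n₁ + ⋯ + n₅ = m₁ + ⋯ + m₅ and n₁³ + ⋯ + n₅³ = m₁³ + ⋯ + m₅³ is at most C · N^{6 + ε}. -/
/-- `S N b` is the number of tuples `(n₁,…,n_b,m₁,…,m_b)` of integers in `{-N,…,N}` with
`n₁+⋯+n_b = m₁+⋯+m_b` and `n₁³+⋯+n_b³ = m₁³+⋯+m_b³`. -/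
noncomputable def S (N b : ℕ) : ℕ :=
  Nat.card {pq : (Fin b → ℤ) × (Fin b → ℤ) //
    (∀ j, pq.1 j ∈ Finset.Icc (-(N : ℤ)) (N : ℤ)) ∧
    (∀ j, pq.2 j ∈ Finset.Icc (-(N : ℤ)) (N : ℤ)) ∧
    (∑ j, pq.1 j) = (∑ j, pq.2 j) ∧ (∑ j, (pq.1 j) ^ 3) = (∑ j, (pq.2 j) ^ 3)}

open Finset

/-- The divisor bound `d(n) ≪ n ^ δ`. -/
theorem exists_card_divisors_le_rpow (δ : ℝ) (hδ : 0 < δ) :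
    ∃ C : ℝ, 1 ≤ C ∧ ∀ n : ℕ, n ≠ 0 → (#n.divisors : ℝ) ≤ C * (n : ℝ) ^ δ := by
  set A : ℝ := max 1 (1 / (δ * Real.log 2)) with hA
  have hlog : 0 < δ * Real.log 2 := mul_pos hδ (Real.log_pos one_lt_two)
  have hA1 : 1 ≤ A := le_max_left _ _
  obtain ⟨B, hB⟩ := exists_nat_gt ((2 : ℝ) ^ (1 / δ))
  have small : ∀ p a : ℕ, 2 ≤ p → (a + 1 : ℝ) ≤ A * ((p : ℝ) ^ a) ^ δ := by
    intro p a hp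
    have hp' : (2 : ℝ) ≤ p := by exact_mod_cast hp
    have h1 : (2 : ℝ) ^ ((a : ℝ) * δ) ≤ ((p : ℝ) ^ a) ^ δ := by
      rw [Real.rpow_mul (by norm_num), Real.rpow_natCast]
      gcongr
    have h2 : 1 + a * (δ * Real.log 2) ≤ (2 : ℝ) ^ ((a : ℝ) * δ) := by
      rw [Real.rpow_def_of_pos (by norm_num)]
      have := Real.add_one_le_exp (Real.log 2 * (a * δ))
      linarith
    have h3 : 1 ≤ A * (δ * Real.log 2) := by
      have := mul_le_mul_of_nonneg_right (le_max_right 1 (1 / (δ * Real.log 2))) hlog.le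
      rwa [one_div_mul_cancel hlog.ne', ← hA] at this
    have h4 : A * (1 + a * (δ * Real.log 2)) ≤ A * ((p : ℝ) ^ a) ^ δ := by
      gcongr
      exact h2.trans h1
    have h5 : (a : ℝ) ≤ a * (A * (δ * Real.log 2)) :=
      le_mul_of_one_le_right (Nat.cast_nonneg a) h3
    linarith
  have large : ∀ p a : ℕ, B ≤ p → (a + 1 : ℝ) ≤ ((p : ℝ) ^ a) ^ δ := by
    intro p a hp
    have hp' : (2 : ℝ) ^ (1 / δ) ≤ p := hB.le.trans (by exact_mod_cast hp)
    have h1 : (2 : ℝ) ≤ (p : ℝ) ^ δ := by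
      calc (2 : ℝ) = ((2 : ℝ) ^ (1 / δ)) ^ δ := by
            rw [← Real.rpow_mul (by norm_num), one_div_mul_cancel hδ.ne', Real.rpow_one]
        _ ≤ _ := by gcongr
    have h2 : ((p : ℝ) ^ a) ^ δ = ((p : ℝ) ^ δ) ^ a := by
      rw [← Real.rpow_natCast, ← Real.rpow_mul (by positivity), mul_comm,
        Real.rpow_mul (by positivity), Real.rpow_natCast]
    rw [h2]
    calc (a + 1 : ℝ) ≤ (2 : ℝ) ^ a := by exact_mod_cast Nat.lt_two_pow_self
      _ ≤ _ := by gcongr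
  refine ⟨A ^ B, one_le_pow₀ hA1, fun n hn => ?_⟩
  have hn' : (n : ℝ) ^ δ = ∏ p ∈ n.primeFactors, ((p : ℝ) ^ n.factorization p) ^ δ := by
    conv_lhs => rw [← Nat.prod_factorization_pow_eq_self hn]
    rw [Finsupp.prod, Nat.support_factorization, Nat.cast_prod,
      ← Real.finsetProd_rpow _ _ (fun i _ => by positivity)]
    simp
  have hc : ∏ p ∈ n.primeFactors, (if p < B then A else 1) ≤ A ^ B := by
    rw [prod_ite, prod_const_one, mul_one, prod_const]
    refine pow_le_pow_right₀ hA1 ?_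
    calc _ ≤ #(range B) := card_le_card fun p hp => by
          simpa using (mem_filter.1 hp).2
      _ = B := card_range B
  rw [Nat.card_divisors hn, hn', Nat.cast_prod]
  calc _ ≤ ∏ p ∈ n.primeFactors,
        ((if p < B then A else 1) * ((p : ℝ) ^ n.factorization p) ^ δ) := by
        refine prod_le_prod (fun _ _ => by positivity) fun p hp => ?_
        push_cast
        split_ifs with h
        · exact small p _ (Nat.prime_of_mem_primeFactors hp).two_le
        · simpa using large p (n.factorization p) (not_lt.1 h)
    _ ≤ _ := by
        rw [prod_mul_distrib]
        gcongr

/-- A set of integer triples with common nonzero product has at most `D ^ 3` elements, where `D`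
bounds the number of integer divisors of that product. -/
theorem card_le_of_mul_eq {α : Type*} (s : Finset α) (φ : α → ℤ × ℤ × ℤ)
    (hφ : Set.InjOn φ s) (c : ℤ) (hc : c ≠ 0)
    (hs : ∀ x ∈ s, (φ x).1 * (φ x).2.1 * (φ x).2.2 = c) (D : ℕ)
    (hD : 2 * #c.natAbs.divisors ≤ D) : #s ≤ D ^ 3 := by
  classical
  set Z : Finset ℤ := c.natAbs.divisors.image (fun d : ℕ => (d : ℤ)) ∪
    c.natAbs.divisors.image (fun d : ℕ => -(d : ℤ)) with hZ
  have hZD : #Z ≤ D := by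
    refine (card_union_le _ _).trans (le_trans ?_ hD)
    rw [two_mul]
    exact add_le_add card_image_le card_image_le
  have hmem : ∀ d : ℤ, d ∣ c → d ∈ Z := by
    intro d hd
    have h : d.natAbs ∈ c.natAbs.divisors :=
      Nat.mem_divisors.2 ⟨Int.natAbs_dvd_natAbs.2 hd, Int.natAbs_ne_zero.2 hc⟩
    rcases Int.natAbs_eq d with h' | h'
    · exact mem_union_left _ (mem_image.2 ⟨_, h, h'.symm⟩)
    · exact mem_union_right _ (mem_image.2 ⟨_, h, h'.symm⟩)
  calc #s ≤ #(Z ×ˢ Z ×ˢ Z) := by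
        refine card_le_card_of_injOn φ (fun x hx => ?_) hφ
        have h := hs x hx
        simp only [coe_product, Set.mem_prod, mem_coe]
        exact ⟨hmem _ ⟨(φ x).2.1 * (φ x).2.2, by rw [← h]; ring⟩,
          hmem _ ⟨(φ x).1 * (φ x).2.2, by rw [← h]; ring⟩,
          hmem _ ⟨(φ x).1 * (φ x).2.1, by rw [← h]; ring⟩⟩
    _ = #Z ^ 3 := by rw [card_product, card_product]; ring
    _ ≤ D ^ 3 := Nat.pow_le_pow_left hZD 3

theorem card_filter_le_card_of_inj {α β : Type*} {s : Finset α} {t : Finset β} {p : α → Prop}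
    [DecidablePred p] (φ : α → β) (hφ : ∀ x ∈ s, φ x ∈ t)
    (hinj : ∀ x y, p x → p y → φ x = φ y → x = y) : #{x ∈ s | p x} ≤ #t :=
  card_le_card_of_injOn φ (fun x hx => hφ x (mem_filter.1 hx).1) fun x hx y hy h =>
    hinj x y (mem_filter.1 hx).2 (mem_filter.1 hy).2 h

theorem card_filter_le_three_mul {α : Type*} [DecidableEq α] {s : Finset α}
    {p q₁ q₂ q₃ : α → Prop} [DecidablePred p] [DecidablePred q₁] [DecidablePred q₂]
    [DecidablePred q₃] {K : ℕ}
    (hp : ∀ x, p x → q₁ x ∨ q₂ x ∨ q₃ x) (h₁ : #{x ∈ s | q₁ x} ≤ K) (h₂ : #{x ∈ s | q₂ x} ≤ K)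
    (h₃ : #{x ∈ s | q₃ x} ≤ K) : #{x ∈ s | p x} ≤ 3 * K := by
  calc #{x ∈ s | p x} ≤ #({x ∈ s | q₁ x} ∪ ({x ∈ s | q₂ x} ∪ {x ∈ s | q₃ x})) := by
        refine card_le_card fun x hx => ?_
        simp only [mem_union, mem_filter] at hx ⊢
        have := hp x hx.2
        tauto
    _ ≤ K + (K + K) := (card_union_le _ _).trans
        (add_le_add h₁ ((card_union_le _ _).trans (add_le_add h₂ h₃)))
    _ = 3 * K := by ring

/-- Cauchy–Schwarz: imposing a further coincidence `g p = g q` with at most `#H` values costs at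
most a factor `#H` in the number of coincidences of `f`. -/
theorem card_coincidences_le {α β γ : Type*} [DecidableEq β] [DecidableEq γ]
    (s : Finset α) (f : α → β) (g : α → γ) (H : Finset γ) (hg : ∀ x ∈ s, g x ∈ H) :
    #{pq ∈ s ×ˢ s | f pq.1 = f pq.2} ≤
      #H * #{pq ∈ s ×ˢ s | f pq.1 = f pq.2 ∧ g pq.1 = g pq.2} := by
  have h1 : #{pq ∈ s ×ˢ s | f pq.1 = f pq.2} = ∑ b ∈ s.image f, #{x ∈ s | f x = b} ^ 2 := by
    rw [card_eq_sum_card_fiberwise (f := fun pq => f pq.1) (t := s.image f)]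
    · refine sum_congr rfl fun b _ => ?_
      rw [sq, ← card_product]
      congr 1
      ext ⟨p, q⟩
      simp only [mem_filter, mem_product]
      grind
    · intro pq hpq
      simp only [coe_filter, mem_product, Set.mem_ofPred_eq] at hpq
      exact mem_coe.2 (mem_image_of_mem f hpq.1.1)
  have h2 : #{pq ∈ s ×ˢ s | f pq.1 = f pq.2 ∧ g pq.1 = g pq.2} =
      ∑ b ∈ s.image f, ∑ h ∈ H, #{x ∈ s | f x = b ∧ g x = h} ^ 2 := by
    rw [← sum_product', card_eq_sum_card_fiberwise (f := fun pq => (f pq.1, g pq.1))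
      (t := s.image f ×ˢ H)]
    · refine sum_congr rfl fun b _ => ?_
      rw [sq, ← card_product]
      congr 1
      ext ⟨p, q⟩
      simp only [mem_filter, mem_product, Prod.ext_iff]
      grind
    · intro pq hpq
      simp only [coe_filter, mem_product, Set.mem_ofPred_eq] at hpq
      exact mem_coe.2 (mem_product.2 ⟨mem_image_of_mem f hpq.1.1, hg _ hpq.1.1⟩)
  rw [h1, h2, mul_sum]
  refine sum_le_sum fun b _ => ?_
  have h3 : #{x ∈ s | f x = b} = ∑ h ∈ H, #{x ∈ s | f x = b ∧ g x = h} := by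
    rw [card_eq_sum_card_fiberwise (f := g) (t := H) fun x hx => hg x (mem_filter.1 hx).1]
    simp only [filter_filter]
  rw [h3]
  exact sq_sum_le_card_mul_sum_sq

/-- The product `(x₁ + x₂) (x₂ + x₃) (x₁ + x₃)`. -/
def pairSumProd (x : ℤ × ℤ × ℤ) : ℤ := (x.1 + x.2.1) * (x.2.1 + x.2.2) * (x.1 + x.2.2)

/-- The sum of the coordinates of a triple. -/
def tripleSum (x : ℤ × ℤ × ℤ) : ℤ := x.1 + x.2.1 + x.2.2

/-- The sum of the cubes of the coordinates of a triple. -/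
def tripleCubeSum (x : ℤ × ℤ × ℤ) : ℤ := x.1 ^ 3 + x.2.1 ^ 3 + x.2.2 ^ 3

theorem tripleSum_pow_three (x : ℤ × ℤ × ℤ) :
    tripleSum x ^ 3 = tripleCubeSum x + 3 * pairSumProd x := by
  simp only [tripleSum, tripleCubeSum, pairSumProd]; ring

theorem natAbs_mul_mul_le {a b c : ℤ} {K : ℕ} (ha : |a| ≤ 2 * K) (hb : |b| ≤ 2 * K)
    (hc : |c| ≤ 2 * K) : (a * b * c).natAbs ≤ 8 * K ^ 3 := by
  zify
  rw [abs_mul, abs_mul]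
  calc |a| * |b| * |c| ≤ (2 * K) * (2 * K) * (2 * K) := by gcongr
    _ = 8 * (K : ℤ) ^ 3 := by ring

section Counting

variable (N D : ℕ)

/-- The integers in `{-N, …, N}`. -/
noncomputable abbrev symmBox : Finset ℤ := Icc (-(N : ℤ)) N

/-- The triples of integers in `{-N, …, N}`. -/
noncomputable abbrev symmBox₃ : Finset (ℤ × ℤ × ℤ) := symmBox N ×ˢ symmBox N ×ˢ symmBox N

theorem card_symmBox : #(symmBox N) = 2 * N + 1 := by
  rw [Int.card_Icc]; omega

theorem card_filter_pairSumProd_eq_zero_tripleSum_eq (t : ℤ) :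
    #{x ∈ symmBox₃ N | pairSumProd x = 0 ∧ tripleSum x = t} ≤ 3 * (2 * N + 1) := by
  rw [← card_symmBox N]
  refine card_filter_le_three_mul
    (q₁ := fun x => x.1 + x.2.1 = 0 ∧ tripleSum x = t)
    (q₂ := fun x => x.2.1 + x.2.2 = 0 ∧ tripleSum x = t)
    (q₃ := fun x => x.1 + x.2.2 = 0 ∧ tripleSum x = t) (fun x hx => ?_)
    (card_filter_le_card_of_inj (fun x => x.1) (fun x hx => (mem_product.1 hx).1) ?_)
    (card_filter_le_card_of_inj (fun x => x.2.1)
      (fun x hx => (mem_product.1 (mem_product.1 hx).2).1) ?_)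
    (card_filter_le_card_of_inj (fun x => x.1) (fun x hx => (mem_product.1 hx).1) ?_)
  · simp only [pairSumProd, mul_eq_zero] at hx
    tauto
  all_goals
    rintro ⟨a, b, c⟩ ⟨a', b', c'⟩ h1 h2 h3
    simp only [tripleSum, Prod.mk.injEq] at *
    omega

theorem card_filter_pairSumProd_eq_zero :
    #{x ∈ symmBox₃ N | pairSumProd x = 0} ≤ 3 * (2 * N + 1) ^ 2 := by
  rw [← card_symmBox N, sq, ← card_product]
  refine card_filter_le_three_mul (q₁ := fun x => x.1 + x.2.1 = 0)
    (q₂ := fun x => x.2.1 + x.2.2 = 0) (q₃ := fun x => x.1 + x.2.2 = 0) (fun x hx => ?_)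
    (card_filter_le_card_of_inj (fun x => (x.1, x.2.2)) (fun x hx => ?_) ?_)
    (card_filter_le_card_of_inj (fun x => (x.1, x.2.1)) (fun x hx => ?_) ?_)
    (card_filter_le_card_of_inj (fun x => (x.1, x.2.1)) (fun x hx => ?_) ?_)
  · simp only [pairSumProd, mul_eq_zero] at hx
    tauto
  case refine_2 | refine_4 | refine_6 =>
    simp only [mem_product] at *
    tauto
  all_goals
    rintro ⟨a, b, c⟩ ⟨a', b', c'⟩ h1 h2 h3
    simp only [Prod.mk.injEq] at *
    omega

/-- The sixth moment: the diagonal number of coincidences, up to the divisor bound. -/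
theorem card_triple_coincidences_le
    (hD : ∀ n : ℕ, n ≠ 0 → n ≤ 8 * N ^ 3 → 2 * #n.divisors ≤ D) :
    #{xy ∈ symmBox₃ N ×ˢ symmBox₃ N |
      tripleSum xy.1 = tripleSum xy.2 ∧ tripleCubeSum xy.1 = tripleCubeSum xy.2} ≤
      (2 * N + 1) ^ 3 * (D ^ 3 + 9) := by
  have hfib : ∀ x ∈ symmBox₃ N,
      #{y ∈ symmBox₃ N | tripleSum x = tripleSum y ∧ tripleCubeSum x = tripleCubeSum y} ≤
        D ^ 3 + if pairSumProd x = 0 then 3 * (2 * N + 1) else 0 := by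
    intro x hx
    have hprod : ∀ y, tripleSum x = tripleSum y → tripleCubeSum x = tripleCubeSum y →
        pairSumProd y = pairSumProd x := by
      intro y h1 h2
      have hx := tripleSum_pow_three x
      have hy := tripleSum_pow_three y
      rw [h1, h2] at hx
      linarith
    split_ifs with h0
    · refine le_trans (card_le_card ?_) ((card_filter_pairSumProd_eq_zero_tripleSum_eq N
        (tripleSum x)).trans (Nat.le_add_left _ _))
      intro y hy
      rw [mem_filter] at hy ⊢
      exact ⟨hy.1, (hprod y hy.2.1 hy.2.2).trans h0, hy.2.1.symm⟩
    · rw [add_zero]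
      refine card_le_of_mul_eq _ (fun y => (y.1 + y.2.1, y.2.1 + y.2.2, y.1 + y.2.2)) ?_
        (pairSumProd x) h0 ?_ D (hD _ (Int.natAbs_ne_zero.2 h0) ?_)
      · rintro ⟨a, b, c⟩ - ⟨d, e, f⟩ - h
        simp only [Prod.mk.injEq] at *
        omega
      · intro y hy
        rw [mem_filter] at hy
        exact hprod y hy.2.1 hy.2.2
      · simp only [mem_product, mem_Icc] at hx
        exact natAbs_mul_mul_le (abs_le.2 (by omega)) (abs_le.2 (by omega))
          (abs_le.2 (by omega))
  rw [card_filter, sum_product]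
  simp only [← card_filter]
  refine (sum_le_sum hfib).trans ?_
  rw [sum_add_distrib, sum_const, ← sum_filter, sum_const, card_product, card_product,
    card_symmBox, smul_eq_mul, smul_eq_mul]
  have := Nat.mul_le_mul_right (3 * (2 * N + 1)) (card_filter_pairSumProd_eq_zero N)
  linarith

theorem card_tripleSum_coincidences_le :
    #{xy ∈ symmBox₃ N ×ˢ symmBox₃ N | tripleSum xy.1 = tripleSum xy.2} ≤ (2 * N + 1) ^ 5 := by
  calc _ ≤ #(symmBox₃ N ×ˢ symmBox N ×ˢ symmBox N) := by
        refine card_le_card_of_injOn (fun xy => (xy.1, xy.2.1, xy.2.2.1)) ?_ ?_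
        · intro xy hxy
          simp only [coe_filter, Set.mem_ofPred_eq, mem_product] at hxy
          simp only [mem_coe, mem_product]
          tauto
        · rintro ⟨⟨a, b, c⟩, d, e, f⟩ h ⟨⟨a', b', c'⟩, d', e', f'⟩ h' heq
          have h1 := (mem_filter.1 (mem_coe.1 h)).2
          have h2 := (mem_filter.1 (mem_coe.1 h')).2
          simp only [tripleSum, Prod.mk.injEq] at *
          omega
    _ = _ := by simp only [card_product, card_symmBox]; ring

/-- The quadruples `((a, b), (c, d))` in the box with `a - b = c - d` and a prescribed value of
`(a ^ 3 - b ^ 3) - (c ^ 3 - d ^ 3)`. -/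
noncomputable def parallelograms (L : ℤ) : Finset ((ℤ × ℤ) × ℤ × ℤ) :=
  {q ∈ (symmBox N ×ˢ symmBox N) ×ˢ symmBox N ×ˢ symmBox N |
    q.1.1 - q.1.2 = q.2.1 - q.2.2 ∧
      (q.1.1 ^ 3 - q.1.2 ^ 3) - (q.2.1 ^ 3 - q.2.2 ^ 3) = L}

theorem cube_sub_cube_sub_eq {a b c d : ℤ} (h : a - b = c - d) :
    (a ^ 3 - b ^ 3) - (c ^ 3 - d ^ 3) = 3 * ((a + d) * (a - b) * (a - c)) := by
  obtain rfl : d = b + c - a := by omega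
  ring

theorem card_parallelograms_le_of_ne_zero
    (hD : ∀ n : ℕ, n ≠ 0 → n ≤ 8 * N ^ 3 → 2 * #n.divisors ≤ D) {L : ℤ} (hL : L ≠ 0) :
    #(parallelograms N L) ≤ D ^ 3 := by
  rcases (parallelograms N L).eq_empty_or_nonempty with h | ⟨⟨⟨a, b⟩, c, d⟩, h0⟩
  · simp [h]
  have hval : ∀ q ∈ parallelograms N L,
      3 * ((q.1.1 + q.2.2) * (q.1.1 - q.1.2) * (q.1.1 - q.2.1)) = L := by
    intro q hq
    obtain ⟨-, h1, h2⟩ := mem_filter.1 hq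
    rw [← cube_sub_cube_sub_eq h1, h2]
  have h1 := hval _ h0
  have hne : (a + d) * (a - b) * (a - c) ≠ 0 := by
    intro h
    simp only [h, mul_zero] at h1
    exact hL h1.symm
  refine card_le_of_mul_eq _ (fun q => (q.1.1 + q.2.2, q.1.1 - q.1.2, q.1.1 - q.2.1)) ?_
    ((a + d) * (a - b) * (a - c)) hne (fun q hq => ?_) D (hD _ (Int.natAbs_ne_zero.2 hne) ?_)
  · rintro ⟨⟨a, b⟩, c, d⟩ h ⟨⟨a', b'⟩, c', d'⟩ h' heq
    have h1 := (mem_filter.1 (mem_coe.1 h)).2.1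
    have h2 := (mem_filter.1 (mem_coe.1 h')).2.1
    simp only [Prod.mk.injEq] at *
    omega
  · have := hval q hq
    simp only at h1 ⊢
    omega
  · have := (mem_filter.1 h0).1
    simp only [mem_product, mem_Icc] at this
    exact natAbs_mul_mul_le (abs_le.2 (by omega)) (abs_le.2 (by omega)) (abs_le.2 (by omega))

theorem card_parallelograms_zero_le : #(parallelograms N 0) ≤ 3 * (2 * N + 1) ^ 2 := by
  rw [← card_symmBox N, sq, ← card_product]
  refine card_filter_le_three_mul
    (q₁ := fun q => q.1.1 - q.1.2 = q.2.1 - q.2.2 ∧ q.1.1 + q.2.2 = 0)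
    (q₂ := fun q => q.1.1 - q.1.2 = q.2.1 - q.2.2 ∧ q.1.1 - q.1.2 = 0)
    (q₃ := fun q => q.1.1 - q.1.2 = q.2.1 - q.2.2 ∧ q.1.1 - q.2.1 = 0) ?_
    (card_filter_le_card_of_inj (fun q => q.1) (fun q hq => (mem_product.1 hq).1) ?_)
    (card_filter_le_card_of_inj (fun q => (q.1.1, q.2.1)) (fun q hq => ?_) ?_)
    (card_filter_le_card_of_inj (fun q => q.1) (fun q hq => (mem_product.1 hq).1) ?_)
  · rintro q ⟨h1, h2⟩
    rw [cube_sub_cube_sub_eq h1] at h2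
    simp only [mul_eq_zero, OfNat.ofNat_ne_zero, false_or] at h2
    tauto
  case refine_3 =>
    simp only [mem_product] at *
    tauto
  all_goals
    rintro ⟨⟨a, b⟩, c, d⟩ ⟨⟨a', b'⟩, c', d'⟩ h1 h2 h3
    simp only [Prod.mk.injEq] at *
    omega

/-- The pair `(n - m + x₁ + x₂ + x₃, n³ - m³ + x₁³ + x₂³ + x₃³)` attached to `((n, m), x)`. -/
def linearCubic (p : (ℤ × ℤ) × ℤ × ℤ × ℤ) : ℤ × ℤ :=
  (p.1.1 - p.1.2 + tripleSum p.2, p.1.1 ^ 3 - p.1.2 ^ 3 + tripleCubeSum p.2)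

theorem card_linearCubic_coincidences_with_sub_eq_le
    (hD : ∀ n : ℕ, n ≠ 0 → n ≤ 8 * N ^ 3 → 2 * #n.divisors ≤ D) :
    #{pq ∈ ((symmBox N ×ˢ symmBox N) ×ˢ symmBox₃ N) ×ˢ ((symmBox N ×ˢ symmBox N) ×ˢ symmBox₃ N) |
      linearCubic pq.1 = linearCubic pq.2 ∧ pq.1.1.1 - pq.1.1.2 = pq.2.1.1 - pq.2.1.2} ≤
      (2 * N + 1) ^ 5 * (4 * D ^ 3 + 27) := by
  set E := {xy ∈ symmBox₃ N ×ˢ symmBox₃ N | tripleSum xy.1 = tripleSum xy.2} with hE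
  calc _ ≤ #(E.sigma fun xy => parallelograms N (tripleCubeSum xy.2 - tripleCubeSum xy.1)) := by
        refine card_le_card_of_injOn
          (fun pq => ⟨(pq.1.2, pq.2.2), (pq.1.1, pq.2.1)⟩) ?_ ?_
        · rintro ⟨⟨⟨a, b⟩, x⟩, ⟨c, d⟩, y⟩ h
          simp only [coe_filter, Set.mem_ofPred_eq, mem_product, linearCubic, Prod.mk.injEq] at h
          simp only [mem_coe, mem_sigma, hE, parallelograms, mem_filter, mem_product]
          obtain ⟨h0, ⟨h1, h2⟩, h3⟩ := h
          refine ⟨⟨by tauto, by linarith⟩, by tauto, h3, by linarith⟩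
        · rintro ⟨⟨p, x⟩, q, y⟩ - ⟨⟨p', x'⟩, q', y'⟩ - h
          simp only [Sigma.mk.injEq, Prod.mk.injEq] at h
          obtain ⟨⟨rfl, rfl⟩, h⟩ := h
          simp only [heq_eq_eq, Prod.mk.injEq] at h
          obtain ⟨rfl, rfl⟩ := h
          rfl
    _ ≤ ∑ xy ∈ E, (D ^ 3 +
          if tripleCubeSum xy.1 = tripleCubeSum xy.2 then 3 * (2 * N + 1) ^ 2 else 0) := by
        rw [card_sigma]
        refine sum_le_sum fun xy _ => ?_
        split_ifs with h
        · rw [h, sub_self]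
          exact (card_parallelograms_zero_le N).trans (Nat.le_add_left _ _)
        · exact card_parallelograms_le_of_ne_zero N D hD (sub_ne_zero.2 (Ne.symm h))
    _ ≤ _ := by
        rw [sum_add_distrib, sum_const, ← sum_filter, sum_const, smul_eq_mul, smul_eq_mul, hE,
          filter_filter]
        have h1 := Nat.mul_le_mul_right (D ^ 3) (card_tripleSum_coincidences_le N)
        have h2 := Nat.mul_le_mul_right (3 * (2 * N + 1) ^ 2) (card_triple_coincidences_le N D hD)
        linarith

theorem card_linearCubic_coincidences_le
    (hD : ∀ n : ℕ, n ≠ 0 → n ≤ 8 * N ^ 3 → 2 * #n.divisors ≤ D) :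
    #{pq ∈ ((symmBox N ×ˢ symmBox N) ×ˢ symmBox₃ N) ×ˢ ((symmBox N ×ˢ symmBox N) ×ˢ symmBox₃ N) |
      linearCubic pq.1 = linearCubic pq.2} ≤ 2 * (2 * N + 1) ^ 6 * (4 * D ^ 3 + 27) := by
  refine (card_coincidences_le _ linearCubic (fun p => p.1.1 - p.1.2)
    (Icc (-(2 * N : ℤ)) (2 * N)) ?_).trans ?_
  · intro p hp
    simp only [mem_product, mem_Icc] at hp ⊢
    omega
  · have h : #(Icc (-(2 * N : ℤ)) (2 * N)) ≤ 2 * (2 * N + 1) := by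
      rw [Int.card_Icc]; omega
    calc _ ≤ 2 * (2 * N + 1) * ((2 * N + 1) ^ 5 * (4 * D ^ 3 + 27)) :=
          Nat.mul_le_mul h (card_linearCubic_coincidences_with_sub_eq_le N D hD)
      _ = _ := by ring

theorem S_five_le_card_linearCubic_coincidences :
    S N 5 ≤
    #{pq ∈ ((symmBox N ×ˢ symmBox N) ×ˢ symmBox₃ N) ×ˢ ((symmBox N ×ˢ symmBox N) ×ˢ symmBox₃ N) |
      linearCubic pq.1 = linearCubic pq.2} := by
  rw [S, ← Fintype.card_coe, ← Nat.card_eq_fintype_card]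
  refine Nat.card_le_card_of_injective (fun pq =>
    ⟨(((pq.1.1 0, pq.1.2 4), pq.1.1 1, pq.1.1 2, pq.1.1 3),
      ((pq.1.2 0, pq.1.1 4), pq.1.2 1, pq.1.2 2, pq.1.2 3)), ?_⟩) ?_
  · obtain ⟨⟨n, m⟩, hn, hm, h1, h3⟩ := pq
    simp only [Fin.sum_univ_five] at h1 h3
    simp only [mem_filter, mem_product, linearCubic, tripleSum, tripleCubeSum, Prod.mk.injEq]
    exact ⟨⟨⟨⟨hn 0, hm 4⟩, hn 1, hn 2, hn 3⟩, ⟨hm 0, hn 4⟩, hm 1, hm 2, hm 3⟩,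
      by linarith, by linarith⟩
  · rintro ⟨⟨n, m⟩, hnm⟩ ⟨⟨n', m'⟩, hnm'⟩ h
    simp only [Subtype.mk.injEq, Prod.mk.injEq] at h ⊢
    constructor <;> funext j <;> fin_cases j <;> simp <;> tauto

end Counting

/-- Hua's estimate: `S(N; 5) ≤ C N^{6+ε}`. -/
theorem stmt_12 (ε : ℝ) (hε : 0 < ε) :
    ∃ C : ℝ, ∀ N : ℕ, 1 ≤ N → (S N 5 : ℝ) ≤ C * (N : ℝ) ^ ((6 : ℝ) + ε) := by
  obtain ⟨K, hK, hdiv⟩ := exists_card_divisors_le_rpow (ε / 9) (by positivity)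
  refine ⟨2 * 3 ^ 6 * (4 * (2 * K * (8 : ℝ) ^ (ε / 9)) ^ 3 + 27), fun N hN => ?_⟩
  have hN' : (1 : ℝ) ≤ N := by exact_mod_cast hN
  set D : ℕ := ⌊2 * K * ((8 * N ^ 3 : ℕ) : ℝ) ^ (ε / 9)⌋₊ with hDdef
  have hD : ∀ n : ℕ, n ≠ 0 → n ≤ 8 * N ^ 3 → 2 * #n.divisors ≤ D := by
    intro n hn hnN
    refine Nat.le_floor ?_
    push_cast
    rw [mul_assoc]
    refine mul_le_mul_of_nonneg_left ((hdiv n hn).trans ?_) zero_le_two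
    have : (n : ℝ) ≤ 8 * (N : ℝ) ^ 3 := by exact_mod_cast hnN
    gcongr
  have hDpow : (D : ℝ) ^ 3 ≤ (2 * K * (8 : ℝ) ^ (ε / 9)) ^ 3 * (N : ℝ) ^ ε := by
    have h1 : (D : ℝ) ≤ 2 * K * (8 : ℝ) ^ (ε / 9) * (N : ℝ) ^ (ε / 3) := by
      refine (Nat.floor_le (by positivity)).trans_eq ?_
      push_cast
      rw [Real.mul_rpow (by norm_num) (by positivity), ← Real.rpow_natCast,
        ← Real.rpow_mul (by positivity), ← mul_assoc]
      congr 2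
      push_cast
      ring
    calc (D : ℝ) ^ 3 ≤ (2 * K * (8 : ℝ) ^ (ε / 9) * (N : ℝ) ^ (ε / 3)) ^ 3 := by gcongr
      _ = _ := by
        rw [mul_pow, ← Real.rpow_natCast ((N : ℝ) ^ (ε / 3)), ← Real.rpow_mul (by positivity)]
        congr 2
        push_cast
        ring
  have hNε : 1 ≤ (N : ℝ) ^ ε := Real.one_le_rpow hN' hε.le
  have hS : (S N 5 : ℝ) ≤ 2 * (2 * N + 1) ^ 6 * (4 * D ^ 3 + 27) := by
    exact_mod_cast (S_five_le_card_linearCubic_coincidences N).trans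
      (card_linearCubic_coincidences_le N D hD)
  have h6 : (N : ℝ) ^ ((6 : ℝ) + ε) = (N : ℝ) ^ 6 * (N : ℝ) ^ ε := by
    rw [Real.rpow_add (by positivity)]
    norm_cast
  calc (S N 5 : ℝ) ≤ 2 * (2 * N + 1) ^ 6 * (4 * D ^ 3 + 27) := hS
    _ ≤ 2 * (3 * N) ^ 6 *
        (4 * ((2 * K * (8 : ℝ) ^ (ε / 9)) ^ 3 * (N : ℝ) ^ ε) + 27 * (N : ℝ) ^ ε) := by
      gcongr
      · linarith
      · linarith
    _ = _ := by rw [h6]; ring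
end

section
/- There exists an absolute constant c > 0 such that the following holds. Let k ≥ 3 be an integer and let m, n₁, …, n_k be integers with |n₁| ≥ |n₂| ≥ ⋯ ≥ |n_k|. Set n = m + n₁ + ⋯ + n_k. If 1000k²|n₂| ≤ |m| ≤ 100k|n₁| and |m + n₁| > 1000k²|n₂|, then |n³ − (m³ + n₁³ + ⋯ + n_k³)| ≥ c · |m|² / k. -/
/-- A perturbation `(a + b + s)³ - (a³ + b³ + t)` of `3ab(a + b)` is still at least
`|a||b||a + b|` in absolute value when `s` and `t` are small. -/
theorem abs_mul_abs_add_le_abs_cube_defect {a b s t p : ℤ} (hs : |s| ≤ p) (ht : |t| ≤ p ^ 3)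
    (hb : 10 * p ≤ |b|) (ha : 3000 * p ≤ |a|) (hab : 3000 * p ≤ |a + b|) :
    |a| * |b| * |a + b| ≤ |(a + (b + s)) ^ 3 - (a ^ 3 + (b ^ 3 + t))| := by
  have hp : 0 ≤ p := (abs_nonneg s).trans hs
  have hsplit : (a + (b + s)) ^ 3 - (a ^ 3 + (b ^ 3 + t)) =
      3 * (a * b * (a + b)) + (3 * (s * (a + b) ^ 2) + 3 * (s ^ 2 * (a + b)) + s ^ 3 - t) := by
    ring
  have hmain : |3 * (a * b * (a + b))| = 3 * (|a| * |b| * |a + b|) := by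
    simp [abs_mul]
  have herr : |3 * (s * (a + b) ^ 2) + 3 * (s ^ 2 * (a + b)) + s ^ 3 - t| ≤
      3 * (p * |a + b| ^ 2) + 3 * (p ^ 2 * |a + b|) + p ^ 3 + p ^ 3 := by
    have h1 : |3 * (s * (a + b) ^ 2)| ≤ 3 * (p * |a + b| ^ 2) := by
      simp only [abs_mul, abs_pow, Nat.abs_ofNat]
      gcongr
    have h2 : |3 * (s ^ 2 * (a + b))| ≤ 3 * (p ^ 2 * |a + b|) := by
      rw [abs_mul, abs_mul, abs_pow, Nat.abs_ofNat]
      gcongr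
    have h3 : |s ^ 3| ≤ p ^ 3 := by
      rw [abs_pow]
      gcongr
    exact (abs_sub _ _).trans (add_le_add ((abs_add_three _ _ _).trans (by gcongr)) ht)
  have hsum : |a + b| ≤ |a| + |b| := abs_add_le a b
  have hA := abs_nonneg a
  have hB := abs_nonneg b
  have hD := abs_nonneg (a + b)
  have htri := abs_sub_abs_le_abs_sub (3 * (a * b * (a + b)))
    (-(3 * (s * (a + b) ^ 2) + 3 * (s ^ 2 * (a + b)) + s ^ 3 - t))
  rw [abs_neg, sub_neg_eq_add, ← hsplit, hmain] at htri
  generalize |a| = A at *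
  generalize |b| = B at *
  generalize |a + b| = D at *
  have e1 : p * D ^ 2 ≤ p * A * D + p * B * D := by
    nlinarith [mul_le_mul_of_nonneg_left hsum (mul_nonneg hp hD)]
  have e2 : 10 * (p * A * D) ≤ A * B * D := by
    nlinarith [mul_le_mul_of_nonneg_left hb (mul_nonneg hA hD)]
  have e3 : 3000 * (p * B * D) ≤ A * B * D := by
    nlinarith [mul_le_mul_of_nonneg_left ha (mul_nonneg hB hD)]
  have e4 : 3000 * (p ^ 2 * D) ≤ p * A * D := by
    nlinarith [mul_le_mul_of_nonneg_left ha (mul_nonneg hp hD)]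
  have e5 : 3000 * p ^ 3 ≤ p ^ 2 * D := by
    nlinarith [mul_le_mul_of_nonneg_left hab (mul_nonneg hp hp)]
  have e6 : 0 ≤ A * B * D := by positivity
  linarith

theorem stmt_17 :
    ∃ c : ℝ, 0 < c ∧ ∀ (k : ℕ) (hk : 3 ≤ k) (m : ℤ) (ns : Fin k → ℤ),
      (∀ i j : Fin k, i ≤ j → |ns j| ≤ |ns i|) →
      1000 * (k : ℤ) ^ 2 * |ns ⟨1, by omega⟩| ≤ |m| →
      |m| ≤ 100 * (k : ℤ) * |ns ⟨0, by omega⟩| →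
      1000 * (k : ℤ) ^ 2 * |ns ⟨1, by omega⟩| < |m + ns ⟨0, by omega⟩| →
      c * (m : ℝ) ^ 2 / (k : ℝ) ≤
        ((|(m + ∑ j, ns j) ^ 3 - (m ^ 3 + ∑ j, (ns j) ^ 3)| : ℤ) : ℝ) := by
  refine ⟨1 / 100, by norm_num, fun k hk m ns hmono h1 h2 h3 => ?_⟩
  obtain ⟨l, rfl⟩ : ∃ l, k = l + 1 := ⟨k - 1, by omega⟩
  have hK : (3 : ℤ) ≤ ((l + 1 : ℕ) : ℤ) := by exact_mod_cast hk
  have hlK : (l : ℤ) ≤ ((l + 1 : ℕ) : ℤ) := by push_cast; linarith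
  have htail : ∀ j : Fin l, |ns j.succ| ≤ |ns ⟨1, by omega⟩| := fun j =>
    hmono _ _ (by rw [Fin.le_def]; simp)
  rw [Fin.sum_univ_succ, Fin.sum_univ_succ (fun j => ns j ^ 3)]
  change |m| ≤ _ * |ns 0| at h2
  change _ < |m + ns 0| at h3
  have hN : 0 ≤ |ns ⟨1, by omega⟩| := abs_nonneg _
  generalize |ns ⟨1, by omega⟩| = N at *
  have hcast : ((l + 1 : ℕ) : ℝ) = (((l + 1 : ℕ) : ℤ) : ℝ) := (Int.cast_natCast _).symm
  rw [hcast]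
  clear hcast
  generalize ((l + 1 : ℕ) : ℤ) = K at *
  have hs : |∑ j : Fin l, ns j.succ| ≤ K * N :=
    calc |∑ j : Fin l, ns j.succ| ≤ ∑ j : Fin l, |ns j.succ| := Finset.abs_sum_le_sum_abs _ _
      _ ≤ ∑ _j : Fin l, N := Finset.sum_le_sum fun j _ => htail j
      _ = l * N := by simp
      _ ≤ K * N := by gcongr
  have ht : |∑ j : Fin l, ns j.succ ^ 3| ≤ (K * N) ^ 3 :=
    calc |∑ j : Fin l, ns j.succ ^ 3| ≤ ∑ j : Fin l, |ns j.succ ^ 3| :=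
          Finset.abs_sum_le_sum_abs _ _
      _ ≤ ∑ _j : Fin l, N ^ 3 := Finset.sum_le_sum fun j _ => by
          rw [abs_pow]; exact pow_le_pow_left₀ (abs_nonneg _) (htail j) 3
      _ = l * N ^ 3 := by simp
      _ ≤ K ^ 3 * N ^ 3 := by
          gcongr
          exact hlK.trans (le_self_pow₀ (by linarith) (by norm_num))
      _ = (K * N) ^ 3 := by ring
  have hKN : 3000 * (K * N) ≤ 1000 * K ^ 2 * N := by
    nlinarith [mul_le_mul_of_nonneg_right hK (mul_nonneg (by linarith : 0 ≤ K) hN)]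
  have hb : 10 * (K * N) ≤ |ns 0| := by
    refine le_of_mul_le_mul_left ?_ (by linarith : 0 < 100 * K)
    linarith [h1.trans h2]
  have hcore := abs_mul_abs_add_le_abs_cube_defect hs ht hb (hKN.trans h1) (hKN.trans h3.le)
  have hD : 1 ≤ |m + ns 0| := (lt_of_le_of_lt (by positivity) h3 : 0 < |m + ns 0|)
  have hfin : m ^ 2 ≤ 100 * K * |(m + (ns 0 + ∑ j : Fin l, ns j.succ)) ^ 3 -
      (m ^ 3 + (ns 0 ^ 3 + ∑ j : Fin l, ns j.succ ^ 3))| :=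
    calc m ^ 2 = |m| * |m| := by rw [← sq, sq_abs]
      _ ≤ |m| * (100 * K * |ns 0|) := by gcongr
      _ = 100 * K * (|m| * |ns 0| * 1) := by ring
      _ ≤ 100 * K * (|m| * |ns 0| * |m + ns 0|) := by gcongr
      _ ≤ _ := by gcongr
  have hKpos : (0 : ℝ) < K := by exact_mod_cast (by linarith : 0 < K)
  rw [div_le_iff₀ hKpos]
  have hfin' := (Int.cast_le (R := ℝ)).mpr hfin
  rw [Int.cast_mul, Int.cast_mul, Int.cast_pow, Int.cast_ofNat] at hfin'
  linarith
end

section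
/- Let k ≥ 3 be an integer and let n₂, n₃, …, n_k be integers with |n₂| ≥ |n₃| ≥ ⋯ ≥ |n_k|. Then |(n₂ + n₃ + ⋯ + n_k)³ − (n₂³ + n₃³ + ⋯ + n_k³)| ≤ 10 k³ |n₂|² |n₃|. -/
/-- Cube of a sum with a dominant term `a`: if `|s| ≤ p * b`, `|t| ≤ p * b ^ 3` and `b ≤ |a|`,
then `(a + s) ^ 3 - (a ^ 3 + t)` is at most a multiple of `|a| ^ 2 * b`. -/
lemma abs_add_cube_sub_le {a s t p b : ℤ} (hp : 0 ≤ p) (hb : 0 ≤ b) (hba : b ≤ |a|)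
    (hs : |s| ≤ p * b) (ht : |t| ≤ p * b ^ 3) :
    |(a + s) ^ 3 - (a ^ 3 + t)| ≤ (p ^ 3 + 3 * p ^ 2 + 4 * p) * |a| ^ 2 * b := by
  have ha : 0 ≤ |a| := abs_nonneg a
  have hb2 : b ^ 2 ≤ |a| ^ 2 := by gcongr
  calc |(a + s) ^ 3 - (a ^ 3 + t)|
      = |3 * a ^ 2 * s + 3 * a * s ^ 2 + s ^ 3 - t| := by ring_nf
    _ ≤ |3 * a ^ 2 * s| + |3 * a * s ^ 2| + |s ^ 3| + |t| :=
        (abs_sub _ _).trans (add_le_add_left (abs_add_three _ _ _) _)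
    _ = 3 * |a| ^ 2 * |s| + 3 * |a| * |s| ^ 2 + |s| ^ 3 + |t| := by
        simp only [abs_mul, abs_pow, Nat.abs_ofNat]
    _ ≤ 3 * |a| ^ 2 * (p * b) + 3 * |a| * (p * b) ^ 2 + (p * b) ^ 3 + p * b ^ 3 := by gcongr
    _ = 3 * p * |a| ^ 2 * b + 3 * p ^ 2 * |a| * b * b + (p ^ 3 + p) * b ^ 2 * b := by ring
    _ ≤ 3 * p * |a| ^ 2 * b + 3 * p ^ 2 * |a| * |a| * b + (p ^ 3 + p) * |a| ^ 2 * b := by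
        gcongr
    _ = (p ^ 3 + 3 * p ^ 2 + 4 * p) * |a| ^ 2 * b := by ring

lemma abs_sum_cube_sub_sum_cube_le (m : ℕ) (f : Fin (m + 2) → ℤ)
    (hf : ∀ i j, i ≤ j → |f j| ≤ |f i|) :
    |(∑ j, f j) ^ 3 - ∑ j, f j ^ 3| ≤ 10 * ((m : ℤ) + 3) ^ 3 * |f 0| ^ 2 * |f 1| := by
  have htail (j : Fin (m + 1)) : |f j.succ| ≤ |f 1| :=
    hf 1 j.succ (Fin.succ_le_succ_iff.mpr (Fin.zero_le j))
  have hs : |∑ j : Fin (m + 1), f j.succ| ≤ ((m : ℤ) + 1) * |f 1| := by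
    refine (Finset.abs_sum_le_sum_abs _ _).trans ?_
    simpa using Finset.sum_le_card_nsmul Finset.univ _ _ fun j _ => htail j
  have ht : |∑ j : Fin (m + 1), f j.succ ^ 3| ≤ ((m : ℤ) + 1) * |f 1| ^ 3 := by
    refine (Finset.abs_sum_le_sum_abs _ _).trans ?_
    have h (j : Fin (m + 1)) : |f j.succ ^ 3| ≤ |f 1| ^ 3 := by
      rw [abs_pow]
      exact pow_le_pow_left₀ (abs_nonneg _) (htail j) 3
    simpa using Finset.sum_le_card_nsmul Finset.univ _ _ fun j _ => h j
  rw [Fin.sum_univ_succ f, Fin.sum_univ_succ (f · ^ 3)]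
  refine (abs_add_cube_sub_le (by positivity) (abs_nonneg _) (hf 0 1 (Fin.zero_le 1)) hs ht).trans
    ?_
  gcongr
  have hm : (0 : ℤ) ≤ m := by positivity
  nlinarith [pow_nonneg hm 2, pow_nonneg hm 3]

/-- Here `ns j` represents `n_{j+2}`, i.e. `ns` enumerates the `k - 1` integers
`n₂, n₃, …, n_k` with `|n₂| ≥ |n₃| ≥ ⋯ ≥ |n_k|`. -/
theorem stmt_18 (k : ℕ) (hk : 3 ≤ k) (ns : Fin (k - 1) → ℤ)
    (hmono : ∀ i j : Fin (k - 1), i ≤ j → |ns j| ≤ |ns i|) :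
    |(∑ j, ns j) ^ 3 - ∑ j, (ns j) ^ 3| ≤
      10 * (k : ℤ) ^ 3 * |ns ⟨0, by omega⟩| ^ 2 * |ns ⟨1, by omega⟩| := by
  obtain ⟨m, rfl⟩ := Nat.exists_eq_add_of_le' hk
  push_cast
  exact abs_sum_cube_sub_sum_cube_le m ns hmono
end
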